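/- Let M be a positive semidefinite real p×p matrix, let A₀ be a positive definite real p×p matrix, and let x_i, x_j, x_l ∈ ℝᵖ. Set v = x_l − x_j, m = (x_j + x_l)/2, and assume c := vᵀ M A₀⁻¹ M v ≠ 0. Let x_min = x_i + (((m − x_i)ᵀ M v)/c) · (A₀⁻¹ M v). Then the minimal ellipsoidal squared distance satisfies (x_i − x_min)ᵀ A₀ (x_i − x_min) = (d²_M(x_i, x_l) − d²_M(x_i, x_j))² / (4 · vᵀ M A₀⁻¹ M v). -/

import Mathlib

open Matrix

/-- A symmetric matrix can be moved across the dot product. -/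
lemma Matrix.PosSemidef.dotProduct_mulVec_comm {n : Type*} [Fintype n]
    {M : Matrix n n ℝ} (hM : M.PosSemidef) (x y : n → ℝ) :
    x ⬝ᵥ (M *ᵥ y) = y ⬝ᵥ (M *ᵥ x) := by
  have hT : Mᵀ = M := by simpa using hM.isHermitian.eq
  rw [dotProduct_mulVec, ← mulVec_transpose, hT, dotProduct_comm]

/-- The difference of the squared Mahalanobis distances from `x` to `z` and to `y` is twice the
bilinear form evaluated at the offset of `x` from the midpoint and at `z - y`. -/
lemma Matrix.PosSemidef.mahalanobis_sub_mahalanobis {n : Type*} [Fintype n]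
    {M : Matrix n n ℝ} (hM : M.PosSemidef) (x y z : n → ℝ) :
    (x - z) ⬝ᵥ (M *ᵥ (x - z)) - (x - y) ⬝ᵥ (M *ᵥ (x - y)) =
      2 * (((y + z) / 2 - x) ⬝ᵥ (M *ᵥ (z - y))) := by
  have hmid : (y + z) / 2 = (1 / 2 : ℝ) • (y + z) := by
    ext i
    simp only [Pi.div_apply, Pi.add_apply, Pi.ofNat_apply, Pi.smul_apply, smul_eq_mul]
    ring
  rw [hmid]
  simp only [mulVec_sub, sub_dotProduct, dotProduct_sub, smul_dotProduct, add_dotProduct,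
    smul_eq_mul]
  linarith [hM.dotProduct_mulVec_comm x y, hM.dotProduct_mulVec_comm x z,
    hM.dotProduct_mulVec_comm y z]

/-- Hyperellipsoid case: the minimal ellipsoidal squared distance equals
`(d²_M(x_i,x_l) − d²_M(x_i,x_j))² / (4 vᵀ M A₀⁻¹ M v)`. -/
theorem ellipsoidal_adversarial_margin_formula {p : ℕ}
    (M : Matrix (Fin p) (Fin p) ℝ) (hM : M.PosSemidef)
    (A₀ : Matrix (Fin p) (Fin p) ℝ) (hA₀ : A₀.PosDef)
    (xi xj xl : Fin p → ℝ)
    (v m : Fin p → ℝ) (hv : v = xl - xj) (hm : m = (xj + xl) / 2)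
    (c : ℝ) (hc : c = v ⬝ᵥ ((M * A₀⁻¹ * M) *ᵥ v)) (hc0 : c ≠ 0)
    (xmin : Fin p → ℝ)
    (hxmin : xmin = xi + (((m - xi) ⬝ᵥ (M *ᵥ v)) / c) • (A₀⁻¹ *ᵥ (M *ᵥ v))) :
    (xi - xmin) ⬝ᵥ (A₀ *ᵥ (xi - xmin)) =
      ((xi - xl) ⬝ᵥ (M *ᵥ (xi - xl)) - (xi - xj) ⬝ᵥ (M *ᵥ (xi - xj))) ^ 2
        / (4 * (v ⬝ᵥ ((M * A₀⁻¹ * M) *ᵥ v))) := by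
  have hdet : IsUnit A₀.det := hA₀.det_pos.ne'.isUnit
  have hcancel : A₀ *ᵥ (A₀⁻¹ *ᵥ (M *ᵥ v)) = M *ᵥ v := by
    rw [mulVec_mulVec, mul_nonsing_inv _ hdet, one_mulVec]
  have hcu : (A₀⁻¹ *ᵥ (M *ᵥ v)) ⬝ᵥ (M *ᵥ v) = c := by
    rw [hM.dotProduct_mulVec_comm, hc, mulVec_mulVec, mulVec_mulVec]
  have hdiff : xi - xmin = -(((m - xi) ⬝ᵥ (M *ᵥ v)) / c) • (A₀⁻¹ *ᵥ (M *ᵥ v)) := by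
    rw [hxmin, neg_smul, sub_add_cancel_left]
  rw [hM.mahalanobis_sub_mahalanobis, ← hm, ← hv, ← hc, hdiff, mulVec_smul, hcancel,
    smul_dotProduct, dotProduct_smul, hcu]
  simp only [smul_eq_mul]
  field_simp
  ring
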